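/- Let L be an even lattice with discriminant group L^♯ ≅ (ℤ/2ℤ)², and let G ⊆ O(L) be a subgroup whose induced action G^♯ on L^♯ exchanges the two generators. Then there is no vector v ∈ L^G with v² = −2 and divisibility (v, L) = 2. -/

import Mathlib

open Matrix

noncomputable section

/-- Integer pairing given by a Gram matrix. -/
def pairZ {n : ℕ} (B : Matrix (Fin n) (Fin n) ℤ) (v w : Fin n → ℤ) : ℤ :=
  v ⬝ᵥ B.mulVec w

/-- The rational bilinear form associated to an integral Gram matrix. -/
def bq {n : ℕ} (B : Matrix (Fin n) (Fin n) ℤ) :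
    LinearMap.BilinForm ℚ (Fin n → ℚ) :=
  Matrix.toBilin' (B.map (Int.cast : ℤ → ℚ))

/-- The canonical map from integer vectors to rational vectors. -/
def iZ (n : ℕ) : (Fin n → ℤ) →ₗ[ℤ] (Fin n → ℚ) where
  toFun x i := (x i : ℚ)
  map_add' x y := by funext i; simp
  map_smul' c x := by funext i; push_cast; simp

/-- The standard lattice `ℤⁿ ⊆ ℚⁿ`. -/
def LZ (n : ℕ) : Submodule ℤ (Fin n → ℚ) := LinearMap.range (iZ n)

/-- The orthogonal complement of `M` inside `S` with respect to `b`. -/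
def orthoIn {n : ℕ} (b : LinearMap.BilinForm ℚ (Fin n → ℚ))
    (M S : Submodule ℤ (Fin n → ℚ)) : Submodule ℤ (Fin n → ℚ) :=
  S ⊓ ⨅ m ∈ (M : Set (Fin n → ℚ)), (LinearMap.ker (b.flip m)).restrictScalars ℤ

/-- The dual lattice `M^∨` of a sublattice `M`, inside `ℚⁿ`. -/
def dualLat {n : ℕ} (b : LinearMap.BilinForm ℚ (Fin n → ℚ))
    (M : Submodule ℤ (Fin n → ℚ)) : Submodule ℤ (Fin n → ℚ) :=
  (Submodule.span ℚ (M : Set (Fin n → ℚ))).restrictScalars ℤ ⊓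
    ⨅ m ∈ (M : Set (Fin n → ℚ)),
      Submodule.comap ((b.flip m).restrictScalars ℤ)
        (LinearMap.range (Algebra.linearMap ℤ ℚ))

/-- The discriminant group `M^♯ = M^∨/M`. -/
abbrev disc {n : ℕ} (b : LinearMap.BilinForm ℚ (Fin n → ℚ))
    (M : Submodule ℤ (Fin n → ℚ)) :=
  (dualLat b M) ⧸ (Submodule.comap (dualLat b M).subtype M)

/-- A lattice is even. -/
def IsEvenLat {n : ℕ} (B : Matrix (Fin n) (Fin n) ℤ) : Prop :=
  ∀ x : Fin n → ℤ, 2 ∣ pairZ B x x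

/-- `M` is a primitive sublattice of `S`. -/
def IsPrimitiveIn {n : ℕ} (M S : Submodule ℤ (Fin n → ℚ)) : Prop :=
  M ≤ S ∧ ∀ x ∈ S, ∀ k : ℤ, k ≠ 0 → k • x ∈ M → x ∈ M

/-- `d` is the divisibility `(v, L)` of `v` in the lattice `ℤⁿ` with Gram matrix `B`:
the greatest positive natural number dividing all pairings of `v` with lattice vectors. -/
def DivIdx {n : ℕ} (B : Matrix (Fin n) (Fin n) ℤ) (v : Fin n → ℤ) (d : ℕ) : Prop :=
  IsGreatest {e : ℕ | 0 < e ∧ ∀ x : Fin n → ℤ, (e : ℤ) ∣ pairZ B v x} d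

/-- The lattice with Gram matrix `B` has signature `(p, q)`. -/
def HasSignature {n : ℕ} (B : Matrix (Fin n) (Fin n) ℤ) (p q : ℕ) : Prop :=
  p + q = n ∧ ∃ P : Matrix (Fin n) (Fin n) ℝ, IsUnit P.det ∧
    Pᵀ * (B.map (Int.cast : ℤ → ℝ)) * P =
      Matrix.diagonal (fun i : Fin n => if (i : ℕ) < p then (1 : ℝ) else -1)

lemma bq_symm {n : ℕ} {B : Matrix (Fin n) (Fin n) ℤ} (hsym : B.IsSymm) (x y : Fin n → ℚ) :
    bq B x y = bq B y x := by
  have h : (B.map (Int.cast : ℤ → ℚ))ᵀ = B.map (Int.cast : ℤ → ℚ) := by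
    rw [← Matrix.transpose_map, hsym.eq]
  simp only [bq, Matrix.toBilin'_apply']
  rw [dotProduct_comm, ← vecMul_transpose, h, dotProduct_mulVec]

lemma bq_iZ {n : ℕ} (B : Matrix (Fin n) (Fin n) ℤ) (v w : Fin n → ℤ) :
    bq B (iZ n v) (iZ n w) = pairZ B v w := by
  simp [bq, Matrix.toBilin'_apply', pairZ, iZ, dotProduct, mulVec]

lemma bq_isometry {n : ℕ} {B φ : Matrix (Fin n) (Fin n) ℤ} (hiso : φᵀ * B * φ = B)
    (x y : Fin n → ℚ) :
    bq B (Matrix.toLin' (φ.map (Int.cast : ℤ → ℚ)) x)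
      (Matrix.toLin' (φ.map (Int.cast : ℤ → ℚ)) y) = bq B x y := by
  have h : (φ.map (Int.cast : ℤ → ℚ))ᵀ * B.map (Int.cast : ℤ → ℚ) * φ.map (Int.cast : ℤ → ℚ)
      = B.map (Int.cast : ℤ → ℚ) := by
    have := congrArg (fun M => M.map (Int.castRingHom ℚ)) hiso
    simp only [Matrix.map_mul] at this
    exact this
  simp only [bq, Matrix.toBilin'_apply', Matrix.toLin'_apply]
  conv_rhs => rw [← h]
  rw [← vecMul_transpose, ← dotProduct_mulVec, mulVec_mulVec, mulVec_mulVec, Matrix.mul_assoc]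

lemma bq_mem_range_of_mem_dualLat {n : ℕ} {b : LinearMap.BilinForm ℚ (Fin n → ℚ)}
    {M : Submodule ℤ (Fin n → ℚ)} {x m : Fin n → ℚ} (hx : x ∈ dualLat b M) (hm : m ∈ M) :
    b x m ∈ LinearMap.range (Algebra.linearMap ℤ ℚ) := by
  have h := (Submodule.mem_inf.1 hx).2
  simp only [Submodule.mem_iInf] at h
  exact h m hm

/-- Half of a lattice vector with even pairings lies in the dual lattice. -/
lemma half_iZ_mem_dualLat {n : ℕ} {B : Matrix (Fin n) (Fin n) ℤ} {v : Fin n → ℤ}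
    (hv : ∀ x : Fin n → ℤ, (2 : ℤ) ∣ pairZ B v x) :
    (1 / 2 : ℚ) • iZ n v ∈ dualLat (bq B) (LZ n) := by
  refine Submodule.mem_inf.2 ⟨?_, ?_⟩
  · exact Submodule.smul_mem (Submodule.span ℚ _) _ (Submodule.subset_span ⟨v, rfl⟩)
  · simp only [Submodule.mem_iInf]
    rintro _ ⟨u, rfl⟩
    obtain ⟨k, hk⟩ := hv u
    refine ⟨k, ?_⟩
    change (k : ℚ) = bq B ((1 / 2 : ℚ) • iZ n v) (iZ n u)
    rw [map_smul, LinearMap.smul_apply, bq_iZ, hk]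
    simp

lemma neg_half_notMem_range : (-1 / 2 : ℚ) ∉ LinearMap.range (Algebra.linearMap ℤ ℚ) := by
  rintro ⟨k, hk⟩
  have h : (2 * k : ℚ) = -1 := by
    change (k : ℚ) = _ at hk
    rw [hk]; norm_num
  have : 2 * k = -1 := by exact_mod_cast h
  omega

/-- If `x` and `y` are dual vectors of equal norm and `2x` is a lattice vector, then every
dual vector congruent to `x + y` modulo the lattice has integral norm. -/
lemma bq_self_mem_range_of_sub_add_mem {n : ℕ} {B : Matrix (Fin n) (Fin n) ℤ} (hsym : B.IsSymm)
    {w x y : Fin n → ℚ} (hw : w ∈ dualLat (bq B) (LZ n)) (hx : x ∈ dualLat (bq B) (LZ n))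
    (hy : y ∈ dualLat (bq B) (LZ n)) (h2x : x + x ∈ LZ n) (hxy : bq B x x = bq B y y)
    (hl : w - (x + y) ∈ LZ n) :
    bq B w w ∈ LinearMap.range (Algebra.linearMap ℤ ℚ) := by
  have key : bq B w w = bq B w (w - (x + y)) + bq B (x + y) (w - (x + y))
      + bq B x (x + x) + bq B y (x + x) := by
    simp only [map_add, map_sub, LinearMap.add_apply, bq_symm hsym w x, bq_symm hsym w y,
      bq_symm hsym y x, ← hxy]
    ring
  rw [key]
  exact add_mem (add_mem (add_mem (bq_mem_range_of_mem_dualLat hw hl)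
    (bq_mem_range_of_mem_dualLat (add_mem hx hy) hl)) (bq_mem_range_of_mem_dualLat hx h2x))
    (bq_mem_range_of_mem_dualLat hy h2x)

/-- let `L` be an even lattice with discriminant group `(ℤ/2)²`
and let `φ` be an isometry of `L` whose induced action on the discriminant
group exchanges the two generators. Then there is no `φ`-invariant vector `v`
with `v² = −2` and divisibility `(v, L) = 2`. -/
theorem stmt17 {n : ℕ} (B : Matrix (Fin n) (Fin n) ℤ)
    (hsym : B.IsSymm) (hnd : B.det ≠ 0) (heven : IsEvenLat B)
    (φ : Matrix (Fin n) (Fin n) ℤ) (hiso : φᵀ * B * φ = B)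
    (e : disc (bq B) (LZ n) ≃+ (ZMod 2 × ZMod 2))
    (F : disc (bq B) (LZ n) →+ disc (bq B) (LZ n))
    (hF : ∀ x : dualLat (bq B) (LZ n), ∃ y : dualLat (bq B) (LZ n),
      (y : Fin n → ℚ) =
        Matrix.toLin' (φ.map (Int.cast : ℤ → ℚ)) (x : Fin n → ℚ) ∧
      F (Submodule.Quotient.mk x) = Submodule.Quotient.mk y)
    (hswap : ∀ d, e (F d) = Prod.swap (e d)) :
    ¬ ∃ v : Fin n → ℤ, φ.mulVec v = v ∧ pairZ B v v = -2 ∧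
      ∀ x : Fin n → ℤ, (2 : ℤ) ∣ pairZ B v x := by
  rintro ⟨v, hφv, hvv, hdiv⟩
  let w : dualLat (bq B) (LZ n) := ⟨(1 / 2 : ℚ) • iZ n v, half_iZ_mem_dualLat hdiv⟩
  have hww : bq B w w = -1 / 2 := by
    change bq B ((1 / 2 : ℚ) • iZ n v) ((1 / 2 : ℚ) • iZ n v) = _
    simp only [map_smul, LinearMap.smul_apply, bq_iZ, hvv]
    norm_num
  have hφw : Matrix.toLin' (φ.map (Int.cast : ℤ → ℚ)) w = (w : Fin n → ℚ) := by
    change Matrix.toLin' _ ((1 / 2 : ℚ) • iZ n v) = (1 / 2 : ℚ) • iZ n v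
    rw [map_smul, Matrix.toLin'_apply]
    congr 1
    conv_rhs => rw [← hφv]
    ext i
    simp [iZ, mulVec, dotProduct]
  have hFw : F (Submodule.Quotient.mk w) = Submodule.Quotient.mk w := by
    obtain ⟨y, hy, h⟩ := hF w
    rw [h, Subtype.ext (hy.trans hφw)]
  have hfix : Prod.swap (e (Submodule.Quotient.mk w)) = e (Submodule.Quotient.mk w) := by
    rw [← hswap, hFw]
  have hcases : ∀ p : ZMod 2 × ZMod 2, p.swap = p → p = 0 ∨ p = (1, 0) + (0, 1) := by decide
  apply neg_half_notMem_range
  rw [← hww]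
  rcases hcases _ hfix with h0 | h1
  · have hw0 := (map_eq_zero_iff e e.injective).1 h0
    rw [Submodule.Quotient.mk_eq_zero] at hw0
    exact bq_mem_range_of_mem_dualLat w.2 hw0
  · obtain ⟨x, hx⟩ := Submodule.Quotient.mk_surjective _ (e.symm (1, 0))
    have hex : e (Submodule.Quotient.mk x) = (1, 0) := by rw [hx, e.apply_symm_apply]
    obtain ⟨y, hy, hFx⟩ := hF x
    have hey : e (Submodule.Quotient.mk y) = (0, 1) := by rw [← hFx, hswap, hex]; rfl
    have h2x : x + x ∈ Submodule.comap (dualLat (bq B) (LZ n)).subtype (LZ n) := by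
      rw [← Submodule.Quotient.mk_eq_zero, ← map_eq_zero_iff e e.injective,
        Submodule.Quotient.mk_add, map_add, hex]
      decide
    have hl : w - (x + y) ∈ Submodule.comap (dualLat (bq B) (LZ n)).subtype (LZ n) := by
      rw [← Submodule.Quotient.eq]
      apply e.injective
      rw [h1, Submodule.Quotient.mk_add, map_add, hex, hey]
    refine bq_self_mem_range_of_sub_add_mem hsym w.2 x.2 y.2 h2x ?_ hl
    rw [hy, bq_isometry hiso]
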